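/- arXiv:2002.02564 — 2 statements merged into one kernel-verified Lean document; each statement's English description precedes it below -/
import Mathlib

section
/- Fix N ≥ 0, let x_ν = 2πν/(2N+1) for ν = 0, ±1, …, ±N, and let f_ν ≥ 0. If there exist ν ≠ ν' with f_ν > 0 and f_{ν'} > 0, then C_N(x) = (1/(2N+1)) Σ_{ν=−N}^{N} f_ν K_N(x − x_ν) is strictly positive for every x ∈ ℝ, where K_N is the Fejér kernel of order N. -/
open Real Finset

/-- The (real form of the) Dirichlet kernel of order `k`. -/
noncomputable def dirichletK (k : ℕ) (u : ℝ) : ℝ :=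
  1 + 2 * ∑ j ∈ Finset.Icc 1 k, Real.cos (j * u)

/-- The Fejér kernel of order `N`: `K_N(u) = (1/(N+1)) Σ_{k=0}^{N} D_k(u)`. -/
noncomputable def fejerK (N : ℕ) (u : ℝ) : ℝ :=
  ((N : ℝ) + 1)⁻¹ * ∑ k ∈ Finset.range (N + 1), dirichletK k u

/-- The equidistant nodes `x_ν = 2πν/(2N+1)`. -/
noncomputable def node (N : ℕ) (ν : ℤ) : ℝ := 2 * Real.pi * ν / (2 * N + 1)

lemma aux_dirichlet (k : ℕ) (v : ℝ) :
    Real.sin v * dirichletK k (2 * v) = Real.sin ((2 * k + 1) * v) := by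
  induction k with
  | zero => simp [dirichletK]
  | succ k ih =>
    have h : dirichletK (k + 1) (2 * v)
        = dirichletK k (2 * v) + 2 * Real.cos (((k + 1 : ℕ) : ℝ) * (2 * v)) := by
      unfold dirichletK
      rw [Finset.sum_Icc_succ_top (by omega)]
      ring
    rw [h, mul_add, ih]
    push_cast
    have e1 : (2 * (k : ℝ) + 1) * v = ((k : ℝ) + 1) * (2 * v) - v := by ring
    have e2 : (2 * ((k : ℝ) + 1) + 1) * v = ((k : ℝ) + 1) * (2 * v) + v := by ring
    rw [e1, e2, Real.sin_sub, Real.sin_add]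
    ring

lemma aux_fejer (n : ℕ) (v : ℝ) :
    Real.sin v ^ 2 * ∑ k ∈ Finset.range n, dirichletK k (2 * v) = Real.sin (n * v) ^ 2 := by
  induction n with
  | zero => simp
  | succ n ih =>
    rw [Finset.sum_range_succ, mul_add, ih]
    have h := aux_dirichlet n v
    have e : Real.sin v ^ 2 * dirichletK n (2 * v)
        = Real.sin v * Real.sin ((2 * n + 1) * v) := by rw [← h]; ring
    rw [e]
    have e1 : (2 * (n : ℝ) + 1) * v = n * v + (n * v + v) := by ring
    have e2 : ((n + 1 : ℕ) : ℝ) * v = n * v + v := by push_cast; ring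
    rw [e1, e2]
    simp only [Real.sin_add, Real.cos_add]
    have h1 := Real.sin_sq_add_cos_sq (n * v)
    have h2 := Real.sin_sq_add_cos_sq v
    linear_combination (-Real.sin (n * v) ^ 2) * h2

lemma aux_pos_of_sin_zero (N : ℕ) (v : ℝ) (h : Real.sin v = 0) : 0 < fejerK N (2 * v) := by
  obtain ⟨m, hm⟩ := Real.sin_eq_zero_iff.1 h
  unfold fejerK
  refine mul_pos (by positivity) (Finset.sum_pos (fun k _ => ?_) (by simp))
  unfold dirichletK
  have : ∀ j ∈ Finset.Icc 1 k, Real.cos ((j : ℝ) * (2 * v)) = 1 := by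
    intro j _
    have e : (j : ℝ) * (2 * v) = ((j * m : ℤ) : ℝ) * (2 * Real.pi) := by
      rw [← hm]; push_cast; ring
    rw [e, Real.cos_int_mul_two_pi]
  rw [Finset.sum_congr rfl this]
  simp
  positivity

lemma aux_nonneg (N : ℕ) (u : ℝ) :
    0 ≤ fejerK N u ∧ (fejerK N u = 0 → ∃ m : ℤ, (m : ℝ) * Real.pi = (N + 1) * (u / 2)) := by
  obtain ⟨v, rfl⟩ : ∃ v, u = 2 * v := ⟨u / 2, by ring⟩
  by_cases h : Real.sin v = 0
  · have := aux_pos_of_sin_zero N v h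
    exact ⟨this.le, fun h0 => absurd h0 this.ne'⟩
  · have hs : 0 < Real.sin v ^ 2 := by positivity
    have hF := aux_fejer (N + 1) v
    have hN : (0 : ℝ) < ((N : ℝ) + 1)⁻¹ := by positivity
    constructor
    · refine mul_nonneg hN.le ?_
      by_contra hc
      have := mul_neg_of_pos_of_neg hs (not_le.1 hc)
      rw [hF] at this
      exact absurd this (not_lt.2 (sq_nonneg _))
    · intro h0
      have h1 : ∑ k ∈ Finset.range (N + 1), dirichletK k (2 * v) = 0 :=
        (mul_eq_zero.1 h0).resolve_left hN.ne'
      rw [h1, mul_zero] at hF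
      obtain ⟨m, hm⟩ := Real.sin_eq_zero_iff.1 (pow_eq_zero_iff (two_ne_zero) |>.1 hF.symm)
      refine ⟨m, ?_⟩
      rw [hm]; push_cast; ring

/-- Strict positivity of the Fejér mixture: if `f_ν ≥ 0` and there exist two distinct
nodes `ν ≠ ν'` with `f_ν > 0` and `f_{ν'} > 0`, then
`C_N(x) = (1/(2N+1)) Σ_{ν=−N}^{N} f_ν K_N(x − x_ν)` is strictly positive for every
`x ∈ ℝ`. -/
theorem fejer_mixture_strictly_positive
    (N : ℕ) (f : ℤ → ℝ) (hf : ∀ ν : ℤ, 0 ≤ f ν)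
    (ν₁ ν₂ : ℤ) (hν₁ : ν₁ ∈ Finset.Icc (-(N : ℤ)) N) (hν₂ : ν₂ ∈ Finset.Icc (-(N : ℤ)) N)
    (hne : ν₁ ≠ ν₂) (hpos₁ : 0 < f ν₁) (hpos₂ : 0 < f ν₂)
    (x : ℝ) :
    0 < (1 / (2 * (N : ℝ) + 1)) *
        ∑ ν ∈ Finset.Icc (-(N : ℤ)) N, f ν * fejerK N (x - node N ν) := by
  refine mul_pos (by positivity) ?_
  have hnn : ∀ ν ∈ Finset.Icc (-(N : ℤ)) N, 0 ≤ f ν * fejerK N (x - node N ν) :=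
    fun ν _ => mul_nonneg (hf ν) (aux_nonneg N _).1
  by_contra hc
  have h0 := le_antisymm (not_lt.1 hc) (Finset.sum_nonneg hnn)
  rw [Finset.sum_eq_zero_iff_of_nonneg hnn] at h0
  obtain ⟨m₁, h₁⟩ := (aux_nonneg N _).2 ((mul_eq_zero.1 (h0 ν₁ hν₁)).resolve_left hpos₁.ne')
  obtain ⟨m₂, h₂⟩ := (aux_nonneg N _).2 ((mul_eq_zero.1 (h0 ν₂ hν₂)).resolve_left hpos₂.ne')
  have hM : (2 * (N : ℝ) + 1) ≠ 0 := by positivity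
  have key : ((m₁ : ℝ) - m₂) * (2 * N + 1) = (N + 1) * (ν₂ - ν₁) := by
    apply mul_right_cancel₀ Real.pi_ne_zero
    unfold node at h₁ h₂
    field_simp at h₁ h₂
    linear_combination (h₁ - h₂) / 2
  have keyZ : (m₁ - m₂) * (2 * (N : ℤ) + 1) = (N + 1) * (ν₂ - ν₁) := by exact_mod_cast key
  have hd : (2 * (N : ℤ) + 1) ∣ ν₂ - ν₁ :=
    ⟨2 * (m₁ - m₂) - (ν₂ - ν₁), by linear_combination (-2) * keyZ⟩
  rw [Finset.mem_Icc] at hν₁ hν₂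
  have := Int.eq_zero_of_abs_lt_dvd hd (by rw [abs_lt]; constructor <;> omega)
  omega
end

section
/- Let p and p̂ be 2π-periodic functions on ℝ that restrict to probability densities on [−π, π], with p > 0 continuously differentiable and p̂ > 0 twice continuously differentiable. Let ℓ = log p and ℓ̂ = log p̂. Then, provided all the integrals involved are finite, ∫_{−π}^{π} p(x) (ℓ'(x) − ℓ̂'(x))² dx = ∫_{−π}^{π} p(x) [ (ℓ̂'(x))² + 2 ℓ̂''(x) ] dx + ∫_{−π}^{π} p(x) (ℓ'(x))² dx. -/
open MeasureTheory Real

/-- Hyvärinen's score-matching identity on the torus.  Let `p` and `p̂` be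
`2π`-periodic functions restricting to probability densities on `[−π, π]`, with
`p > 0` continuously differentiable and `p̂ > 0` twice continuously differentiable.
With `ℓ = log p` and `ℓ̂ = log p̂`,
`∫_{−π}^{π} p (ℓ' − ℓ̂')² = ∫_{−π}^{π} p ((ℓ̂')² + 2ℓ̂'') + ∫_{−π}^{π} p (ℓ')²`. -/
theorem score_matching_identity_torus
    (p phat : ℝ → ℝ)
    (hp_per : Function.Periodic p (2 * Real.pi))
    (hphat_per : Function.Periodic phat (2 * Real.pi))
    (hp_pos : ∀ x, 0 < p x) (hphat_pos : ∀ x, 0 < phat x)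
    (hp_smooth : ContDiff ℝ 1 p) (hphat_smooth : ContDiff ℝ 2 phat)
    (hp_one : (∫ x in (-Real.pi)..Real.pi, p x) = 1)
    (hphat_one : (∫ x in (-Real.pi)..Real.pi, phat x) = 1)
    (ℓ ℓhat : ℝ → ℝ)
    (hℓ : ℓ = fun x => Real.log (p x)) (hℓhat : ℓhat = fun x => Real.log (phat x)) :
    (∫ x in (-Real.pi)..Real.pi, p x * (deriv ℓ x - deriv ℓhat x) ^ 2)
      = (∫ x in (-Real.pi)..Real.pi,
            p x * ((deriv ℓhat x) ^ 2 + 2 * deriv (deriv ℓhat) x))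
        + ∫ x in (-Real.pi)..Real.pi, p x * (deriv ℓ x) ^ 2 := by
  have hℓs : ContDiff ℝ 1 ℓ := by
    rw [hℓ]; exact hp_smooth.log (fun x => (hp_pos x).ne')
  have hℓhs : ContDiff ℝ 2 ℓhat := by
    rw [hℓhat]; exact hphat_smooth.log (fun x => (hphat_pos x).ne')
  have hv1 : ContDiff ℝ 1 (deriv ℓhat) :=
    ((contDiff_succ_iff_deriv (n := 1)).1 (by simpa [one_add_one_eq_two] using hℓhs)).2.2
  have cp : Continuous p := hp_smooth.continuous
  have cp' : Continuous (deriv p) := hp_smooth.continuous_deriv le_rfl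
  have cℓ' : Continuous (deriv ℓ) := hℓs.continuous_deriv le_rfl
  have cv : Continuous (deriv ℓhat) := hv1.continuous
  have cv' : Continuous (deriv (deriv ℓhat)) := hv1.continuous_deriv le_rfl
  have hderiv : ∀ x, p x * deriv ℓ x = deriv p x := by
    intro x
    have h := ((hp_smooth.differentiable one_ne_zero x).hasDerivAt.log (hp_pos x).ne').deriv
    rw [hℓ, h]
    field_simp [(hp_pos x).ne']
  have e : (-Real.pi) + 2 * Real.pi = Real.pi := by ring
  have hpe : p Real.pi = p (-Real.pi) := by
    have := hp_per (-Real.pi)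
    rwa [e] at this
  have hve : deriv ℓhat Real.pi = deriv ℓhat (-Real.pi) := by
    have hper : (fun x => ℓhat (x + 2 * Real.pi)) = ℓhat := by
      funext x
      simp only [hℓhat, hphat_per x]
    have h := deriv_comp_add_const ℓhat (2 * Real.pi) (-Real.pi)
    rw [hper, e] at h
    exact h.symm
  have hibp : ∫ x in (-Real.pi)..Real.pi,
      (deriv p x * deriv ℓhat x + p x * deriv (deriv ℓhat) x) = 0 := by
    rw [intervalIntegral.integral_deriv_mul_eq_sub
      (fun x _ => (hp_smooth.differentiable one_ne_zero x).hasDerivAt)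
      (fun x _ => (hv1.differentiable one_ne_zero x).hasDerivAt)
      (cp'.intervalIntegrable _ _) (cv'.intervalIntegrable _ _), hpe, hve, sub_self]
  have hpt : ∀ x, p x * (deriv ℓ x - deriv ℓhat x) ^ 2
      = (p x * ((deriv ℓhat x) ^ 2 + 2 * deriv (deriv ℓhat) x) + p x * (deriv ℓ x) ^ 2)
        - 2 * (deriv p x * deriv ℓhat x + p x * deriv (deriv ℓhat) x) := by
    intro x
    rw [← hderiv x]; ring
  simp_rw [hpt]
  rw [intervalIntegral.integral_sub, intervalIntegral.integral_add,
    intervalIntegral.integral_const_mul, hibp]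
  · ring
  all_goals
    apply Continuous.intervalIntegrable
    fun_prop
end
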